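/- Let n ≥ 2 and let σ be a finite sequence in sawtooth form with all entries in {1, …, n−1}. If more than n−1 entries of σ are equal to 1, then G(σ) contains an empty unpierced box or an empty unpierced hexagon of type 1 or type 2. -/

import Mathlib

/-- A finite sequence of natural numbers is in sawtooth form if whenever an entry
is less than the next one, the next one is exactly one more. -/
def Sawtooth (σ : List ℕ) : Prop :=
  ∀ i : ℕ, i + 1 < σ.length →
    σ.getD i 0 < σ.getD (i + 1) 0 → σ.getD (i + 1) 0 = σ.getD i 0 + 1

/-- A commutation swaps two adjacent entries whose values differ by more than 1. -/
def Commutation (σ τ : List ℕ) : Prop :=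
  ∃ (l r : List ℕ) (x y : ℕ),
    (x + 1 < y ∨ y + 1 < x) ∧ σ = l ++ x :: y :: r ∧ τ = l ++ y :: x :: r

/-- `(i, j)` is a dot of the dot graph `G(σ)` (the first coordinate is 1-based). -/
def IsDot (σ : List ℕ) (i j : ℤ) : Prop :=
  ∃ k : Fin σ.length, i = ((k : ℕ) : ℤ) + 1 ∧ j = ((σ.get k : ℕ) : ℤ)

/-- The dots `(a, y), (a+1, y+1), …, (a+t, y+t)` all belong to `G(σ)`; equivalently
(for `0 ≤ t`) the dots `(a, y)` and `(a+t, y+t)` lie on a common ascending segment. -/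
def OnAsc (σ : List ℕ) (a y t : ℤ) : Prop :=
  ∀ s : ℤ, 0 ≤ s → s ≤ t → IsDot σ (a + s) (y + s)

/-- The dots `(a, y), …, (a+m, y+m)` form an entire (i.e. maximal) ascending segment. -/
def IsAscSeg (σ : List ℕ) (a y : ℤ) (m : ℕ) : Prop :=
  OnAsc σ a y (m : ℤ) ∧ ¬ IsDot σ (a - 1) (y - 1) ∧
    ¬ IsDot σ (a + (m : ℤ) + 1) (y + (m : ℤ) + 1)

/-- A box of `G(σ)` with lower horizontal edge from `(a, y)` to `(b, y)` and
ascending edges of length `t`. -/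
def IsBox (σ : List ℕ) (a b y t : ℤ) : Prop :=
  0 ≤ t ∧ a + t < b ∧
  OnAsc σ a y t ∧ ¬ IsDot σ (a + t + 1) (y + t + 1) ∧
  OnAsc σ b y t ∧ ¬ IsDot σ (b - 1) (y - 1)

/-- No dot of `G(σ)` lies in the open interior of either horizontal edge of the box. -/
def BoxUnpierced (σ : List ℕ) (a b y t : ℤ) : Prop :=
  (∀ i : ℤ, a < i → i < b → ¬ IsDot σ i y) ∧
  (∀ i : ℤ, a + t < i → i < b + t → ¬ IsDot σ i (y + t))

/-- No dot of `G(σ)` lies in the open interior of the box. -/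
def BoxEmpty (σ : List ℕ) (a b y t : ℤ) : Prop :=
  ∀ i h : ℤ, y < h → h < y + t → a + (h - y) < i → i < b + (h - y) → ¬ IsDot σ i h

/-- The closed region of the box. -/
def BoxRegion (a b y t : ℤ) : Set (ℤ × ℤ) :=
  {p | y ≤ p.2 ∧ p.2 ≤ y + t ∧ a + (p.2 - y) ≤ p.1 ∧ p.1 ≤ b + (p.2 - y)}

/-- A hexagon of type 1 of `G(σ)`. -/
def IsHex1 (σ : List ℕ) (a b c y L M : ℤ) : Prop :=
  0 ≤ M ∧ M ≤ L ∧ a < b ∧ b + M < c ∧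
  OnAsc σ a y L ∧ ¬ IsDot σ (a + L + 1) (y + L + 1) ∧
  OnAsc σ b y M ∧ ¬ IsDot σ (b - 1) (y - 1) ∧ ¬ IsDot σ (b + M + 1) (y + M + 1) ∧
  OnAsc σ c (y + M) (L - M)

/-- No dot of `G(σ)` lies in the open interior of any of the three horizontal
edges of the type 1 hexagon. -/
def Hex1Unpierced (σ : List ℕ) (a b c y L M : ℤ) : Prop :=
  (∀ i : ℤ, a < i → i < b → ¬ IsDot σ i y) ∧
  (∀ i : ℤ, b + M < i → i < c → ¬ IsDot σ i (y + M)) ∧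
  (∀ i : ℤ, a + L < i → i < c + L - M → ¬ IsDot σ i (y + L))

/-- The open interior of the type 1 hexagon. -/
def Hex1Interior (a b c y L M : ℤ) : Set (ℤ × ℤ) :=
  {p | y < p.2 ∧ p.2 < y + L ∧ a + (p.2 - y) < p.1 ∧
    (p.2 ≤ y + M → p.1 < b + (p.2 - y)) ∧ (y + M ≤ p.2 → p.1 < c + (p.2 - y - M))}

/-- No dot of `G(σ)` lies in the open interior of the type 1 hexagon. -/
def Hex1Empty (σ : List ℕ) (a b c y L M : ℤ) : Prop :=
  ∀ p ∈ Hex1Interior a b c y L M, ¬ IsDot σ p.1 p.2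

/-- The closed region of the type 1 hexagon (open interior together with its
horizontal and ascending edges). -/
def Hex1Region (a b c y L M : ℤ) : Set (ℤ × ℤ) :=
  {p | y ≤ p.2 ∧ p.2 ≤ y + L ∧ a + (p.2 - y) ≤ p.1 ∧
    (p.2 < y + M → p.1 ≤ b + (p.2 - y)) ∧ (y + M ≤ p.2 → p.1 ≤ c + (p.2 - y - M))}

/-- A hexagon of type 2 of `G(σ)`. -/
def IsHex2 (σ : List ℕ) (p q r y L M : ℤ) : Prop :=
  0 ≤ M ∧ M ≤ L ∧ p < q ∧ p + (L - M) < r ∧ r + M < q + L ∧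
  OnAsc σ p y (L - M) ∧
  OnAsc σ r (y + L - M) M ∧ ¬ IsDot σ (r - 1) (y + L - M - 1) ∧
    ¬ IsDot σ (r + M + 1) (y + L + 1) ∧
  OnAsc σ q y L ∧ ¬ IsDot σ (q - 1) (y - 1)

/-- No dot of `G(σ)` lies in the open interior of any of the three horizontal
edges of the type 2 hexagon. -/
def Hex2Unpierced (σ : List ℕ) (p q r y L M : ℤ) : Prop :=
  (∀ i : ℤ, p < i → i < q → ¬ IsDot σ i y) ∧
  (∀ i : ℤ, p + (L - M) < i → i < r → ¬ IsDot σ i (y + L - M)) ∧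
  (∀ i : ℤ, r + M < i → i < q + L → ¬ IsDot σ i (y + L))

/-- The open interior of the type 2 hexagon. -/
def Hex2Interior (p q r y L M : ℤ) : Set (ℤ × ℤ) :=
  {x | y < x.2 ∧ x.2 < y + L ∧ x.1 < q + (x.2 - y) ∧
    (x.2 ≤ y + L - M → p + (x.2 - y) < x.1) ∧
    (y + L - M ≤ x.2 → r + (x.2 - y - L + M) < x.1)}

/-- No dot of `G(σ)` lies in the open interior of the type 2 hexagon. -/
def Hex2Empty (σ : List ℕ) (p q r y L M : ℤ) : Prop :=
  ∀ x ∈ Hex2Interior p q r y L M, ¬ IsDot σ x.1 x.2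

/-- The closed region of the type 2 hexagon (open interior together with its
horizontal and ascending edges). -/
def Hex2Region (p q r y L M : ℤ) : Set (ℤ × ℤ) :=
  {x | y ≤ x.2 ∧ x.2 ≤ y + L ∧ x.1 ≤ q + (x.2 - y) ∧
    (x.2 ≤ y + L - M → p + (x.2 - y) ≤ x.1) ∧
    (y + L - M < x.2 → r + (x.2 - y - L + M) ≤ x.1)}

/-- The number of dots of `G(σ)` lying in a region `R`. -/
noncomputable def DotsIn (σ : List ℕ) (R : Set (ℤ × ℤ)) : ℕ :=
  {p : ℤ × ℤ | IsDot σ p.1 p.2 ∧ p ∈ R}.ncard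

/-- A region `RQ` is strictly inside a region `RP` (with respect to `G(σ)`) if
`RQ ⊆ RP` and `RQ` contains strictly fewer dots of `G(σ)` than `RP`. -/
def StrictlyInside (σ : List ℕ) (RQ RP : Set (ℤ × ℤ)) : Prop :=
  RQ ⊆ RP ∧ DotsIn σ RQ < DotsIn σ RP

/-- A dot graph polygon: a box, a hexagon of type 1, or a hexagon of type 2. -/
inductive DGPoly : Type where
  | box (a b y t : ℤ)
  | hex1 (a b c y L M : ℤ)
  | hex2 (p q r y L M : ℤ)

/-- The polygon is genuinely a box/hexagon of type 1/hexagon of type 2 of `G(σ)`. -/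
def DGPoly.Valid (σ : List ℕ) : DGPoly → Prop
  | .box a b y t => IsBox σ a b y t
  | .hex1 a b c y L M => IsHex1 σ a b c y L M
  | .hex2 p q r y L M => IsHex2 σ p q r y L M

/-- The polygon is unpierced. -/
def DGPoly.Unpierced (σ : List ℕ) : DGPoly → Prop
  | .box a b y t => BoxUnpierced σ a b y t
  | .hex1 a b c y L M => Hex1Unpierced σ a b c y L M
  | .hex2 p q r y L M => Hex2Unpierced σ p q r y L M

/-- The polygon is empty. -/
def DGPoly.IsEmpty (σ : List ℕ) : DGPoly → Prop
  | .box a b y t => BoxEmpty σ a b y t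
  | .hex1 a b c y L M => Hex1Empty σ a b c y L M
  | .hex2 p q r y L M => Hex2Empty σ p q r y L M

/-- The closed region of the polygon. -/
def DGPoly.Region : DGPoly → Set (ℤ × ℤ)
  | .box a b y t => BoxRegion a b y t
  | .hex1 a b c y L M => Hex1Region a b c y L M
  | .hex2 p q r y L M => Hex2Region p q r y L M

/-- A box of the graph of `f` whose left edge starts at `a`, whose right edge starts at `b`, and
whose ascending edges have length `t`. -/
def GBox (f : ℤ → ℤ) (a b t : ℤ) : Prop :=
  0 ≤ t ∧ a + t < b ∧ (∀ s, 0 ≤ s → s ≤ t → f (a + s) = f a + s) ∧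
  (∀ s, 0 ≤ s → s ≤ t → f (b + s) = f a + s) ∧
  f (a + t + 1) ≠ f a + t + 1 ∧ f (b - 1) ≠ f a - 1

/-- One of the two horizontal edges of the box is unpierced. -/
def HalfUnpierced (f : ℤ → ℤ) (a b t : ℤ) : Prop :=
  (∀ i, a + t < i → i < b → f i ≠ f a) ∨ (∀ i, a + t < i → i < b → f i ≠ f a + t)

/-- An unpierced hexagon of type 1 of the graph of `f`, with `L = M + D` and `0 < D`. -/
def GHex1 (f : ℤ → ℤ) (a b c D M : ℤ) : Prop :=
  0 ≤ M ∧ 0 < D ∧ a + M + D < b ∧ b + M < c ∧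
  (∀ s, 0 ≤ s → s ≤ M + D → f (a + s) = f a + s) ∧
  (∀ s, 0 ≤ s → s ≤ M → f (b + s) = f a + s) ∧
  (∀ s, 0 ≤ s → s ≤ D → f (c + s) = f a + M + s) ∧
  f (a + M + D + 1) ≠ f a + M + D + 1 ∧ f (b - 1) ≠ f a - 1 ∧
  f (b + M + 1) ≠ f a + M + 1 ∧
  (∀ i, a + M + D < i → i < b → f a < f i ∧ f i < f a + M + D) ∧
  (∀ i, b + M < i → i < c → f i < f a + M)

/-- An unpierced hexagon of type 2 of the graph of `f`, with `L = M + D` and `0 < D`. -/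
def GHex2 (f : ℤ → ℤ) (p q r D M : ℤ) : Prop :=
  0 ≤ M ∧ 0 < D ∧ p + D < r ∧ r + M < q ∧
  (∀ s, 0 ≤ s → s ≤ D → f (p + s) = f p + s) ∧
  (∀ s, 0 ≤ s → s ≤ M → f (r + s) = f p + D + s) ∧
  (∀ s, 0 ≤ s → s ≤ M + D → f (q + s) = f p + s) ∧
  f (r - 1) ≠ f p + D - 1 ∧ f (r + M + 1) ≠ f p + D + M + 1 ∧ f (q - 1) ≠ f p - 1 ∧
  (∀ i, p + D < i → i < r → f p + D < f i) ∧
  (∀ i, r + M < i → i < q → f p < f i ∧ f i < f p + D + M)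

/-- The graph of `f` over `[1, N]` has a polygon with nothing between its first two
(respectively last two) ascending edges. -/
def HasTight (f : ℤ → ℤ) (N : ℤ) : Prop :=
  (∃ a t, 1 ≤ a ∧ a + t + 1 + t ≤ N ∧ GBox f a (a + t + 1) t) ∨
  (∃ a c D M, 1 ≤ a ∧ c + D ≤ N ∧ GHex1 f a (a + M + D + 1) c D M) ∨
  (∃ p r D M, 1 ≤ p ∧ r + M + 1 + M + D ≤ N ∧ GHex2 f p (r + M + 1) r D M)

/-- Every nonempty window has a first position at which a minimum is attained. -/
theorem exists_first_min (f : ℤ → ℤ) {u v : ℤ} (h : u + 1 < v) :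
    ∃ r, u < r ∧ r < v ∧ (∀ i, u < i → i < v → f r ≤ f i) ∧ (∀ i, u < i → i < r → f r < f i) := by
  obtain ⟨k, rfl⟩ : ∃ k : ℕ, v = u + 2 + k := ⟨(v - u - 2).toNat, by omega⟩
  clear h
  induction k with
  | zero => exact ⟨u + 1, by omega, by omega, fun i h1 h2 => by
      obtain rfl : i = u + 1 := by omega
      exact le_rfl, fun i h1 h2 => by omega⟩
  | succ k ih =>
    obtain ⟨r, h1, h2, h3, h4⟩ := ih
    by_cases hlt : f (u + 2 + k) < f r
    · refine ⟨u + 2 + k, by omega, by push_cast; omega, fun i hi hi' => ?_, fun i hi hi' => ?_⟩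
      · by_cases he : i = u + 2 + k
        · rw [he]
        · have := h3 i hi (by push_cast at hi'; omega)
          omega
      · have := h3 i hi hi'
        omega
    · refine ⟨r, h1, by push_cast; omega, fun i hi hi' => ?_, h4⟩
      by_cases he : i = u + 2 + k
      · rw [he]; omega
      · exact h3 i hi (by push_cast at hi'; omega)

/-- Every nonempty window has a last position at which a maximum is attained. -/
theorem exists_last_max (f : ℤ → ℤ) {u v : ℤ} (h : u + 1 < v) :
    ∃ e, u < e ∧ e < v ∧ (∀ i, u < i → i < v → f i ≤ f e) ∧ (∀ i, e < i → i < v → f i < f e) := by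
  obtain ⟨r, h1, h2, h3, h4⟩ :=
    exists_first_min (fun i => - f (-i)) (show -v + 1 < -u by omega)
  refine ⟨-r, by omega, by omega, fun i hi hi' => ?_, fun i hi hi' => ?_⟩
  · have := h3 (-i) (by omega) (by omega)
    simp only [neg_neg] at this
    omega
  · have := h4 (-i) (by omega) (by omega)
    simp only [neg_neg] at this
    omega

/-- An occurrence of a value in a window yields a first one. -/
theorem exists_first_eq (f : ℤ → ℤ) {u v y j : ℤ} (h1 : u < j) (h2 : j < v) (h3 : f j = y) :
    ∃ j, u < j ∧ j < v ∧ f j = y ∧ ∀ i, u < i → i < j → f i ≠ y := by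
  obtain ⟨r, hr, hr', hmin, hfst⟩ :=
    exists_first_min (fun i => if f i = y then 0 else 1) (show u + 1 < v by omega)
  have hry : f r = y := by
    have := hmin j h1 h2
    by_contra hne
    simp [h3, hne] at this
  refine ⟨r, hr, hr', hry, fun i hi hi' he => ?_⟩
  have := hfst i hi hi'
  simp [he, hry] at this

/-- An occurrence of a value in a window yields a last one. -/
theorem exists_last_eq (f : ℤ → ℤ) {u v y j : ℤ} (h1 : u < j) (h2 : j < v) (h3 : f j = y) :
    ∃ j, u < j ∧ j < v ∧ f j = y ∧ ∀ i, j < i → i < v → f i ≠ y := by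
  obtain ⟨r, hr, hr', hry, hfst⟩ :=
    exists_first_eq (fun i => f (-i)) (show -v < -j by omega) (show -j < -u by omega)
      (by simpa using h3)
  refine ⟨-r, by omega, by omega, hry, fun i hi hi' he => ?_⟩
  exact hfst (-i) (by omega) (by omega) (by simpa using he)

/-- The maximal ascending run to the right of `i`. -/
theorem exists_run_right (f : ℤ → ℤ) {i k : ℤ} (hik : i ≤ k) (hk : f (k + 1) ≠ f k + 1) :
    ∃ h, 0 ≤ h ∧ i + h ≤ k ∧ (∀ s, 0 ≤ s → s ≤ h → f (i + s) = f i + s) ∧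
      f (i + h + 1) ≠ f i + h + 1 := by
  obtain ⟨j, hj, hj', hj1, hj2⟩ :=
    exists_first_eq (fun j => if f (j + 1) = f j + 1 then 0 else 1) (u := i - 1) (v := k + 1)
      (y := 1) (j := k) (by omega) (by omega) (by simp [hk])
  have hrun : ∀ s : ℕ, (s : ℤ) ≤ j - i → f (i + s) = f i + s := by
    intro s
    induction s with
    | zero => simp
    | succ s ih =>
      intro hs
      push_cast at hs ⊢
      have h1 := ih (by omega)
      have h2 := hj2 (i + s) (by omega) (by omega)
      have h3 : f (i + s + 1) = f (i + s) + 1 := by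
        by_contra hne
        simp [hne] at h2
      rw [← add_assoc, h3]
      omega
  have hrun' : ∀ s, 0 ≤ s → s ≤ j - i → f (i + s) = f i + s := by
    intro s hs hs'
    lift s to ℕ using hs
    exact hrun s hs'
  refine ⟨j - i, by omega, by omega, hrun', fun he => ?_⟩
  have h4 := hrun' (j - i) (by omega) le_rfl
  simp only [add_sub_cancel] at h4 he
  have h5 : f (j + 1) = f j + 1 := by omega
  simp [h5] at hj1

/-- The maximal ascending run to the left of `i`. -/
theorem exists_run_left (f : ℤ → ℤ) {i k : ℤ} (hik : k ≤ i) (hk : f (k - 1) ≠ f k - 1) :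
    ∃ h, 0 ≤ h ∧ k ≤ i - h ∧ (∀ s, 0 ≤ s → s ≤ h → f (i - s) = f i - s) ∧
      f (i - h - 1) ≠ f i - h - 1 := by
  obtain ⟨h, h0, h1, h2, h3⟩ :=
    exists_run_right (fun j => - f (-j)) (show -i ≤ -k by omega) (by
      simp only [neg_neg, neg_add]
      rw [← sub_eq_add_neg]
      omega)
  refine ⟨h, h0, by omega, fun s hs hs' => ?_, fun he => h3 ?_⟩
  · have := h2 s hs hs'
    simp only [neg_neg, neg_add] at this
    rw [← sub_eq_add_neg] at this
    omega
  · simp only [neg_neg, neg_add]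
    rw [← sub_eq_add_neg, ← sub_eq_add_neg]
    omega

/-- A value that a sawtooth window avoids, and that follows the window without being approached
from below, bounds the window from below. -/
theorem lt_of_ne_of_sawtooth {f : ℤ → ℤ} (hf : ∀ i, f (i + 1) ≤ f i + 1) {u v y : ℤ}
    (hv : f v = y) (hv' : f (v - 1) ≠ y - 1) (hne : ∀ i, u < i → i < v → f i ≠ y) :
    ∀ i, u < i → i < v → y < f i := by
  intro i hi hiv
  by_contra hlt
  have key : ∀ k : ℕ, i + k < v → f (i + k) < y := by
    intro k
    induction k with
    | zero =>
      have := hne i hi hiv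
      intro _
      simp only [Nat.cast_zero, add_zero]
      omega
    | succ k ih =>
      intro hk
      push_cast at hk ⊢
      have h1 := ih (by omega)
      have h2 := hf (i + k)
      have h3 := hne (i + k + 1) (by omega) (by omega)
      rw [← add_assoc]
      omega
  have h1 := key (v - 1 - i).toNat (by omega)
  have h2 : i + ((v - 1 - i).toNat : ℤ) = v - 1 := by omega
  rw [h2] at h1
  have h3 := hf (v - 1)
  rw [sub_add_cancel] at h3
  omega

/-- A value that a sawtooth window avoids, and that precedes the window without being continued
upwards, bounds the window from above. -/
theorem gt_of_ne_of_sawtooth {f : ℤ → ℤ} (hf : ∀ i, f (i + 1) ≤ f i + 1) {u v y : ℤ}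
    (hu : f u = y) (hu' : f (u + 1) ≠ y + 1) (hne : ∀ i, u < i → i < v → f i ≠ y) :
    ∀ i, u < i → i < v → f i < y := by
  intro i hi hiv
  have := lt_of_ne_of_sawtooth (f := fun i => - f (-i)) (u := -v) (v := -u) (y := -y)
    (fun i => by
      have := hf (-i - 1)
      simp only [neg_add, ← sub_eq_add_neg, sub_add_cancel] at this ⊢
      omega)
    (by simp [hu])
    (by
      simp only [neg_sub, sub_neg_eq_add, add_comm (1 : ℤ)]
      omega)
    (fun i hi hi' h => hne (-i) (by omega) (by omega) (by omega))
    (-i) (by omega) (by omega)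
  simp only [neg_neg] at this
  omega

/-- After an ascending run ending at `u`, either the window stays below the top of the run, or it
contains the right edge of a box whose top edge is unpierced. -/
theorem lt_top_or_box {f : ℤ → ℤ} (hf : ∀ i, f (i + 1) ≤ f i + 1) {u v h : ℤ}
    (hrun : ∀ s, 0 ≤ s → s ≤ h → f (u - s) = f u - s) (hu : f (u + 1) ≠ f u + 1)
    (hge : ∀ i, u < i → i < v → f u - h ≤ f i) :
    (∀ i, u < i → i < v → f i < f u) ∨
      ∃ a b t, u - h ≤ a ∧ b + t < v ∧ GBox f a b t ∧ HalfUnpierced f a b t := by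
  by_cases hex : ∃ j, u < j ∧ j < v ∧ f j = f u
  · right
    obtain ⟨j, hj, hjv, hju⟩ := hex
    obtain ⟨j, hj, hjv, hju, hfst⟩ := exists_first_eq f hj hjv hju
    obtain ⟨d, hd, hdj, hdrun, hdx⟩ := exists_run_left f (i := j) (k := u + 1) (by omega)
      (by rw [add_sub_cancel_right]; omega)
    have h1 := hge (j - d) (by omega) (by omega)
    have h2 := hdrun d hd le_rfl
    have h3 := hrun d hd (by omega)
    refine ⟨u - d, j - d, d, by omega, by omega, ⟨hd, by omega, fun s hs hsd => ?_,
      fun s hs hsd => ?_, ?_, ?_⟩, Or.inr fun i hi hi' => ?_⟩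
    · have := hrun (d - s) (by omega) (by omega)
      rw [show u - d + s = u - (d - s) by ring]
      omega
    · have := hdrun (d - s) (by omega) (by omega)
      rw [show j - d + s = j - (d - s) by ring]
      omega
    · rw [sub_add_cancel]
      omega
    · omega
    · have := hfst i (by omega) (by omega)
      omega
  · left
    push Not at hex
    exact gt_of_ne_of_sawtooth hf rfl hu hex

/-- Before an ascending run starting at `v`, either the window stays above the bottom of the run,
or it contains the left edge of a box whose bottom edge is unpierced. -/
theorem gt_bot_or_box {f : ℤ → ℤ} (hf : ∀ i, f (i + 1) ≤ f i + 1) {u v d : ℤ}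
    (hrun : ∀ s, 0 ≤ s → s ≤ d → f (v + s) = f v + s) (hv : f (v - 1) ≠ f v - 1)
    (hle : ∀ i, u < i → i < v → f i ≤ f v + d) :
    (∀ i, u < i → i < v → f v < f i) ∨
      ∃ a b t, u < a ∧ b + t ≤ v + d ∧ GBox f a b t ∧ HalfUnpierced f a b t := by
  by_cases hex : ∃ j, u < j ∧ j < v ∧ f j = f v
  · right
    obtain ⟨j, hj, hjv, hju⟩ := hex
    obtain ⟨j, hj, hjv, hju, hlst⟩ := exists_last_eq f hj hjv hju
    obtain ⟨h, hh, hhj, hhrun, hhx⟩ := exists_run_right f (i := j) (k := v - 1) (by omega)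
      (by rw [sub_add_cancel]; omega)
    have h1 := hle (j + h) (by omega) (by omega)
    have h2 := hhrun h hh le_rfl
    refine ⟨j, v, h, by omega, by omega, ⟨hh, by omega, hhrun,
      fun s hs hsd => ?_, hhx, by omega⟩, Or.inl fun i hi hi' => ?_⟩
    · have := hrun s hs (by omega)
      omega
    · have := hlst i (by omega) (by omega)
      omega
  · left
    push Not at hex
    exact lt_of_ne_of_sawtooth hf rfl hv hex

/-- The ascending segment of the first minimum of a window bounded by ends of segments. -/
theorem exists_min_segment {f : ℤ → ℤ} (hf : ∀ i, f (i + 1) ≤ f i + 1) {u v : ℤ}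
    (huv : u + 1 < v) (hu : f (u + 1) ≠ f u + 1) (hv : f (v - 1) ≠ f v - 1) :
    (∃ a b t, u < a ∧ b + t < v ∧ GBox f a b t ∧ HalfUnpierced f a b t) ∨
    ∃ r h, u < r ∧ 0 ≤ h ∧ r + h < v ∧ (∀ s, 0 ≤ s → s ≤ h → f (r + s) = f r + s) ∧
      f (r - 1) ≠ f r - 1 ∧ f (r + h + 1) ≠ f r + h + 1 ∧
      (∀ i, u < i → i < v → f r ≤ f i) ∧ (∀ i, u < i → i < r → f r < f i) ∧
      (∀ i, r + h < i → i < v → f i < f r + h) := by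
  obtain ⟨r, hr, hrv, hmin, hfst⟩ := exists_first_min f huv
  obtain ⟨h, hh, hhj, hrun, hx⟩ := exists_run_right f (i := r) (k := v - 1) (by omega)
    (by rw [sub_add_cancel]; omega)
  have hrh := hrun h hh le_rfl
  rcases lt_top_or_box hf (u := r + h) (v := v) (h := h)
    (fun s hs hs' => by
      have := hrun (h - s) (by omega) (by omega)
      rw [show r + h - s = r + (h - s) by ring]
      omega)
    (by omega) (fun i hi hi' => by
      have := hmin i (by omega) (by omega)
      omega) with hlt | ⟨a, b, t, h1, h2, h3⟩
  · refine Or.inr ⟨r, h, hr, hh, by omega, hrun, ?_, hx, hmin, hfst, fun i hi hi' => ?_⟩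
    · by_cases he : u = r - 1
      · rw [← he]
        have : f (u + 1) = f r := by rw [he, sub_add_cancel]
        omega
      · have := hmin (r - 1) (by omega) (by omega)
        omega
    · have := hlt i hi hi'
      omega
  · exact Or.inl ⟨a, b, t, by omega, h2, h3⟩

/-- The ascending segment of the last maximum of a window bounded by ends of segments. -/
theorem exists_max_segment {f : ℤ → ℤ} (hf : ∀ i, f (i + 1) ≤ f i + 1) {u v : ℤ}
    (huv : u + 1 < v) (hu : f (u + 1) ≠ f u + 1) (hv : f (v - 1) ≠ f v - 1) :
    (∃ a b t, u < a ∧ b + t < v ∧ GBox f a b t ∧ HalfUnpierced f a b t) ∨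
    ∃ e d, u < e ∧ 0 ≤ d ∧ e + d < v ∧ (∀ s, 0 ≤ s → s ≤ d → f (e + s) = f e + s) ∧
      f (e - 1) ≠ f e - 1 ∧ f (e + d + 1) ≠ f e + d + 1 ∧
      (∀ i, u < i → i < v → f i ≤ f e + d) ∧ (∀ i, e + d < i → i < v → f i < f e + d) ∧
      (∀ i, u < i → i < e → f e < f i) := by
  obtain ⟨e, he, hev, hmax, hlst⟩ := exists_last_max f huv
  obtain ⟨d, hd, hdj, hrun, hx⟩ := exists_run_left f (i := e) (k := u + 1) (by omega)
    (by rw [add_sub_cancel_right]; omega)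
  have hed := hrun d hd le_rfl
  have hrun' : ∀ s, 0 ≤ s → s ≤ d → f (e - d + s) = f (e - d) + s := fun s hs hs' => by
    have := hrun (d - s) (by omega) (by omega)
    rw [show e - d + s = e - (d - s) by ring]
    omega
  rcases gt_bot_or_box hf (u := u) (v := e - d) (d := d) hrun' (by omega)
    (fun i hi hi' => by
      have := hmax i (by omega) (by omega)
      omega) with hlt | ⟨a, b, t, h1, h2, h3⟩
  · refine Or.inr ⟨e - d, d, by omega, hd, by omega, hrun', by omega, ?_, fun i hi hi' => ?_,
      fun i hi hi' => ?_, hlt⟩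
    · rw [sub_add_cancel]
      by_cases he : v = e + 1
      · rw [← he]
        have : f (v - 1) = f e := by rw [he, add_sub_cancel_right]
        omega
      · have := hmax (e + 1) (by omega) (by omega)
        omega
    · have := hmax i hi hi'
      omega
    · have := hlst i (by omega) hi'
      omega
  · exact Or.inl ⟨a, b, t, by omega, by omega, h3⟩

/-- A half-unpierced box or an unpierced hexagon yields a tight polygon, by descent on the
horizontal extent. -/
theorem hasTight_of_polygon {f : ℤ → ℤ} (hf : ∀ i, f (i + 1) ≤ f i + 1) (N : ℤ) (K : ℕ) :
    (∀ a b t, 1 ≤ a → b + t ≤ N → GBox f a b t → HalfUnpierced f a b t → b + t - a ≤ K →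
      HasTight f N) ∧
    (∀ a b c D M, 1 ≤ a → c + D ≤ N → GHex1 f a b c D M → c + D - a ≤ K → HasTight f N) ∧
    (∀ p q r D M, 1 ≤ p → q + M + D ≤ N → GHex2 f p q r D M → q + M + D - p ≤ K →
      HasTight f N) := by
  induction K with
  | zero =>
    refine ⟨?_, ?_, ?_⟩
    · rintro a b t - - ⟨h1, h2, -⟩ - h
      push_cast at h
      omega
    · rintro a b c D M - - ⟨h1, h2, h3, h4, -⟩ h
      push_cast at h
      omega
    · rintro p q r D M - - ⟨h1, h2, h3, h4, -⟩ h
      push_cast at h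
      omega
  | succ K ih =>
    obtain ⟨ihB, ih1, ih2⟩ := ih
    push_cast
    refine ⟨?_, ?_, ?_⟩
    · rintro a b t ha hN ⟨ht, hab, hA, hB, hAx, hBx⟩ hhalf hK
      have hat := hA t ht le_rfl
      have hb0 : f b = f a := by simpa using hB 0 le_rfl ht
      obtain ⟨hlow, hhigh⟩ | hT :
          ((∀ i, a + t < i → i < b → f a < f i) ∧ (∀ i, a + t < i → i < b → f i < f a + t)) ∨
            HasTight f N := by
        rcases hhalf with hbot | htop
        · have hlow := lt_of_ne_of_sawtooth hf hb0 hBx hbot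
          rcases lt_top_or_box hf (u := a + t) (v := b) (h := t)
            (fun s hs hs' => by
              have := hA (t - s) (by omega) (by omega)
              rw [show a + t - s = a + (t - s) by ring]
              omega)
            (by omega) (fun i hi hi' => by
              have := hlow i hi hi'
              omega) with h | ⟨a', b', t', h1, h2, h3, h4⟩
          · exact Or.inl ⟨hlow, fun i hi hi' => by
              have := h i hi hi'
              omega⟩
          · exact Or.inr (ihB a' b' t' (by omega) (by omega) h3 h4 (by omega))
        · have hhigh := gt_of_ne_of_sawtooth hf hat hAx htop
          rcases gt_bot_or_box hf (u := a + t) (v := b) (d := t)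
            (fun s hs hs' => by
              have := hB s hs hs'
              omega)
            (by omega) (fun i hi hi' => by
              have := hhigh i hi hi'
              omega) with h | ⟨a', b', t', h1, h2, h3, h4⟩
          · exact Or.inl ⟨fun i hi hi' => by
              have := h i hi hi'
              omega, hhigh⟩
          · exact Or.inr (ihB a' b' t' (by omega) (by omega) h3 h4 (by omega))
      swap
      · exact hT
      by_cases he : b = a + t + 1
      · subst he
        exact Or.inl ⟨a, t, ha, hN, ht, hab, hA, hB, hAx, hBx⟩
      rcases exists_min_segment hf (u := a + t) (v := b) (by omega) (by omega) (by omega) with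
        ⟨a', b', t', h1, h2, h3, h4⟩ | ⟨r, h, hr, hh, hrb, hrun, hrx, hrhx, hmin, hfst, htop⟩
      · exact ihB a' b' t' (by omega) (by omega) h3 h4 (by omega)
      · have hm := hlow r (by omega) (by omega)
        have hg := hhigh (r + h) (by omega) (by omega)
        have hrh := hrun h hh le_rfl
        refine ih2 a b r (f r - f a) h ha (by omega)
          ⟨hh, by omega, by omega, by omega, fun s hs hs' => hA s hs (by omega),
            fun s hs hs' => ?_, fun s hs hs' => hB s hs (by omega), by omega, by omega, hBx,
            fun i hi hi' => ?_, fun i hi hi' => ?_⟩ (by omega)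
        · have := hrun s hs hs'
          omega
        · by_cases hia : i ≤ a + t
          · have := hA (i - a) (by omega) (by omega)
            rw [add_sub_cancel] at this
            omega
          · have := hfst i (by omega) hi'
            omega
        · have := hlow i (by omega) hi'
          have := htop i hi hi'
          omega
    · rintro a b c D M ha hN ⟨hM, hD, hab, hbc, hA, hB, hC, hAx, hBx, hBx', hW, hV⟩ hK
      have hat := hA (M + D) (by omega) le_rfl
      have hb0 : f b = f a := by simpa using hB 0 le_rfl hM
      by_cases he : b = a + M + D + 1
      · subst he
        exact Or.inr (Or.inl ⟨a, c, D, M, ha, hN, hM, hD, hab, hbc, hA, hB, hC, hAx, hBx, hBx',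
          hW, hV⟩)
      rw [← add_assoc] at hat
      rcases exists_max_segment hf (u := a + M + D) (v := b) (by omega) (by omega) (by omega) with
        ⟨a', b', t', h1, h2, h3, h4⟩ | ⟨e, d, hae, hd, hdb, hrun, hex, hedx, hmax, hlst, hbot⟩
      · exact ihB a' b' t' (by omega) (by omega) h3 h4 (by omega)
      have hs0 := hW e (by omega) (by omega)
      have hed := hrun d hd le_rfl
      have hq := hW (e + d) (by omega) (by omega)
      by_cases hqM : f a + M < f e + d
      · have hae0 := hA (f e - f a) (by omega) (by omega)
        refine ih1 (a + (f e - f a)) e (c + (f e + d - f a - M)) (f a + M + D - f e - d) d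
          (by omega) (by omega)
          ⟨hd, by omega, by omega, by omega, fun s hs hs' => ?_,
            fun s hs hs' => ?_, fun s hs hs' => ?_, ?_, by omega, by omega,
            fun i hi hi' => ?_, fun i hi hi' => ?_⟩ (by omega)
        · have := hA (f e - f a + s) (by omega) (by omega)
          rw [add_assoc]
          omega
        · have := hrun s hs hs'
          omega
        · have := hC (f e + d - f a - M + s) (by omega) (by omega)
          rw [add_assoc]
          omega
        · rw [show a + (f e - f a) + d + (f a + M + D - f e - d) + 1 = a + M + D + 1 by ring]
          omega
        · have := hbot i (by omega) hi'
          have := hW i (by omega) (by omega)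
          omega
        · rw [hae0]
          by_cases h1 : i < b
          · have := hlst i hi h1
            omega
          by_cases h2 : i ≤ b + M
          · have := hB (i - b) (by omega) (by omega)
            rw [add_sub_cancel] at this
            omega
          by_cases h3 : i < c
          · have := hV i (by omega) h3
            omega
          · have := hC (i - c) (by omega) (by omega)
            rw [add_sub_cancel] at this
            omega
      · rcases exists_min_segment hf (u := a + M + D) (v := b) (by omega) (by omega) (by omega) with
          ⟨a', b', t', h1, h2, h3, h4⟩ | ⟨r, h, hr, hh, hrb, hrun', hrx, hrhx, hmin, hfst, htop⟩
        · exact ihB a' b' t' (by omega) (by omega) h3 h4 (by omega)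
        have hm := hW r (by omega) (by omega)
        have hrh := hrun' h hh le_rfl
        have hg := hmax (r + h) (by omega) (by omega)
        refine ih2 a b r (f r - f a) h ha (by omega)
          ⟨hh, by omega, by omega, by omega, fun s hs hs' => hA s hs (by omega),
            fun s hs hs' => ?_, fun s hs hs' => hB s hs (by omega), by omega, by omega, hBx,
            fun i hi hi' => ?_, fun i hi hi' => ?_⟩ (by omega)
        · have := hrun' s hs hs'
          omega
        · by_cases hia : i ≤ a + M + D
          · have := hA (i - a) (by omega) (by omega)
            rw [add_sub_cancel] at this
            omega
          · have := hfst i (by omega) hi'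
            omega
        · have := hW i (by omega) hi'
          have := htop i hi hi'
          omega
    · rintro p q r D M hp hN ⟨hM, hD, hpr, hrq, hA, hB, hC, hBx, hBx', hCx, hV, hW⟩ hK
      have hr0 : f r = f p + D := by simpa using hB 0 le_rfl hM
      have hrM := hB M hM le_rfl
      have hq0 : f q = f p := by simpa using hC 0 le_rfl (by omega)
      by_cases he : q = r + M + 1
      · subst he
        exact Or.inr (Or.inr ⟨p, r, D, M, hp, hN, hM, hD, hpr, hrq, hA, hB, hC, hBx, hBx', hCx,
          hV, hW⟩)
      rcases exists_min_segment hf (u := r + M) (v := q) (by omega) (by omega) (by omega) with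
        ⟨a', b', t', h1, h2, h3, h4⟩ | ⟨r', h, hr, hh, hrb, hrun, hrx, hrhx, hmin, hfst, htop⟩
      · exact ihB a' b' t' (by omega) (by omega) h3 h4 (by omega)
      have hm := hW r' (by omega) (by omega)
      have hrh := hrun h hh le_rfl
      have hg := hW (r' + h) (by omega) (by omega)
      by_cases hmD : f r' < f p + D
      · refine ih2 p q r' (f r' - f p) h hp (by omega)
          ⟨hh, by omega, by omega, by omega, fun s hs hs' => hA s hs (by omega),
            fun s hs hs' => ?_, fun s hs hs' => hC s hs (by omega), by omega, by omega, hCx,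
            fun i hi hi' => ?_, fun i hi hi' => ?_⟩ (by omega)
        · have := hrun s hs hs'
          omega
        · by_cases h1 : i ≤ p + D
          · have := hA (i - p) (by omega) (by omega)
            rw [add_sub_cancel] at this
            omega
          by_cases h2 : i < r
          · have := hV i (by omega) h2
            omega
          by_cases h3 : i ≤ r + M
          · have := hB (i - r) (by omega) (by omega)
            rw [add_sub_cancel] at this
            omega
          · have := hfst i (by omega) hi'
            omega
        · have := hW i (by omega) hi'
          have := htop i hi hi'
          omega
      · rcases exists_max_segment hf (u := r + M) (v := q) (by omega) (by omega) (by omega) with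
          ⟨a', b', t', h1, h2, h3, h4⟩ | ⟨e, d, hae, hd, hdb, hrun', hex, hedx, hmax, hlst, hbot⟩
        · exact ihB a' b' t' (by omega) (by omega) h3 h4 (by omega)
        have hs0 := hmin e (by omega) (by omega)
        have hed := hrun' d hd le_rfl
        have hqv := hW (e + d) (by omega) (by omega)
        have hre0 := hB (f e - f p - D) (by omega) (by omega)
        refine ih1 (r + (f e - f p - D)) e (q + (f e + d - f p)) (f p + D + M - f e - d) d
          (by omega) (by omega)
          ⟨hd, by omega, by omega, by omega, fun s hs hs' => ?_,
            fun s hs hs' => ?_, fun s hs hs' => ?_, ?_, by omega, by omega,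
            fun i hi hi' => ?_, fun i hi hi' => ?_⟩ (by omega)
        · have := hB (f e - f p - D + s) (by omega) (by omega)
          rw [add_assoc]
          omega
        · have := hrun' s hs hs'
          omega
        · have := hC (f e + d - f p + s) (by omega) (by omega)
          rw [add_assoc]
          omega
        · rw [show r + (f e - f p - D) + d + (f p + D + M - f e - d) + 1 = r + M + 1 by ring]
          omega
        · have := hbot i (by omega) hi'
          have := hW i (by omega) (by omega)
          omega
        · rw [hre0]
          by_cases h1 : i < q
          · have := hlst i hi h1
            omega
          · have := hC (i - q) (by omega) (by omega)
            rw [add_sub_cancel] at this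
            omega

/-- Tight polygons of the graph of `f` are empty unpierced polygons of `G(σ)`. -/
theorem exists_poly_of_hasTight {σ : List ℕ} {f : ℤ → ℤ} {N : ℤ}
    (hdot : ∀ i j, IsDot σ i j ↔ 1 ≤ i ∧ i ≤ N ∧ f i = j) (hT : HasTight f N) :
    ∃ P : DGPoly, P.Valid σ ∧ P.Unpierced σ ∧ P.IsEmpty σ := by
  rcases hT with ⟨a, t, ha, hN, ht, hab, hA, hB, hAx, hBx⟩ |
    ⟨a, c, D, M, ha, hN, hM, hD, hab, hbc, hA, hB, hC, hAx, hBx, hBx', hW, hV⟩ |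
    ⟨p, r, D, M, hp, hN, hM, hD, hpr, hrq, hA, hB, hC, hBx, hBx', hCx, hV, hW⟩
  · have hA' : ∀ i, a ≤ i → i ≤ a + t → f i = f a + (i - a) := fun i h1 h2 => by
      simpa using hA (i - a) (by omega) (by omega)
    have hB' : ∀ i, a + t + 1 ≤ i → i ≤ a + t + 1 + t → f i = f a + (i - (a + t + 1)) :=
      fun i h1 h2 => by simpa using hB (i - (a + t + 1)) (by omega) (by omega)
    refine ⟨.box a (a + t + 1) (f a) t, ?_, ?_, ?_⟩
    · simp only [DGPoly.Valid, IsBox, OnAsc, hdot]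
      refine ⟨ht, hab, fun s hs hs' => ⟨by omega, by omega, hA s hs hs'⟩, fun h => hAx h.2.2,
        fun s hs hs' => ⟨by omega, by omega, hB s hs hs'⟩, fun h => hBx h.2.2⟩
    · simp only [DGPoly.Unpierced, BoxUnpierced, hdot]
      refine ⟨fun i h1 h2 h3 => ?_, fun i h1 h2 h3 => ?_⟩
      · have := hA' i (by omega) (by omega)
        omega
      · have := hB' i (by omega) (by omega)
        omega
    · simp only [DGPoly.IsEmpty, BoxEmpty, hdot]
      intro i h h1 h2 h3 h4 h5
      have := hA' i
      have := hB' i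
      omega
  · have hA' : ∀ i, a ≤ i → i ≤ a + M + D → f i = f a + (i - a) := fun i h1 h2 => by
      simpa using hA (i - a) (by omega) (by omega)
    have hB' : ∀ i, a + M + D + 1 ≤ i → i ≤ a + M + D + 1 + M → f i = f a + (i - (a + M + D + 1)) :=
      fun i h1 h2 => by simpa using hB (i - (a + M + D + 1)) (by omega) (by omega)
    have hC' : ∀ i, c ≤ i → i ≤ c + D → f i = f a + M + (i - c) := fun i h1 h2 => by
      simpa using hC (i - c) (by omega) (by omega)
    refine ⟨.hex1 a (a + M + D + 1) c (f a) (M + D) M, ?_, ?_, ?_⟩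
    · simp only [DGPoly.Valid, IsHex1, OnAsc, hdot]
      refine ⟨hM, by omega, by omega, hbc, fun s hs hs' => ⟨by omega, by omega, hA s hs hs'⟩,
        fun h => hAx ?_, fun s hs hs' => ⟨by omega, by omega, hB s hs hs'⟩, fun h => hBx h.2.2,
        fun h => hBx' h.2.2, fun s hs hs' => ⟨by omega, by omega, hC s hs (by omega)⟩⟩
      simpa [add_assoc] using h.2.2
    · simp only [DGPoly.Unpierced, Hex1Unpierced, hdot]
      refine ⟨fun i h1 h2 h3 => ?_, fun i h1 h2 h3 => ?_, fun i h1 h2 h3 => ?_⟩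
      · have := hA' i
        omega
      · have := hV i h1 h2
        omega
      · have := hB' i
        have := hV i
        have := hC' i
        omega
    · simp only [DGPoly.IsEmpty, Hex1Empty, Hex1Interior, hdot, Set.mem_ofPred_eq, Prod.forall]
      rintro i h ⟨h1, h2, h3, h4, h5⟩ h6
      have := hA' i
      have := hB' i
      have := hV i
      have := hC' i
      omega
  · have hA' : ∀ i, p ≤ i → i ≤ p + D → f i = f p + (i - p) := fun i h1 h2 => by
      simpa using hA (i - p) (by omega) (by omega)
    have hB' : ∀ i, r ≤ i → i ≤ r + M → f i = f p + D + (i - r) :=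
      fun i h1 h2 => by simpa using hB (i - r) (by omega) (by omega)
    have hC' : ∀ i, r + M + 1 ≤ i → i ≤ r + M + 1 + M + D → f i = f p + (i - (r + M + 1)) :=
      fun i h1 h2 => by simpa using hC (i - (r + M + 1)) (by omega) (by omega)
    have hD' : M + D - M = D := by ring
    have hE : f p + (M + D) - M = f p + D := by ring
    refine ⟨.hex2 p (r + M + 1) r (f p) (M + D) M, ?_, ?_, ?_⟩
    · simp only [DGPoly.Valid, IsHex2, OnAsc, hdot, hD', hE]
      refine ⟨hM, by omega, by omega, hpr, by omega,
        fun s hs hs' => ⟨by omega, by omega, hA s hs hs'⟩,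
        fun s hs hs' => ⟨by omega, by omega, hB s hs hs'⟩, fun h => hBx h.2.2,
        fun h => hBx' ?_, fun s hs hs' => ⟨by omega, by omega, hC s hs hs'⟩, fun h => hCx h.2.2⟩
      have := h.2.2
      omega
    · simp only [DGPoly.Unpierced, Hex2Unpierced, hdot, hD', hE]
      refine ⟨fun i h1 h2 h3 => ?_, fun i h1 h2 h3 => ?_, fun i h1 h2 h3 => ?_⟩
      · have := hA' i
        have := hV i
        have := hB' i
        omega
      · have := hV i h1 h2
        omega
      · have := hC' i
        omega
    · simp only [DGPoly.IsEmpty, Hex2Empty, Hex2Interior, hdot, Set.mem_ofPred_eq, Prod.forall]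
      rintro i h ⟨h1, h2, h3, h4, h5⟩ h6
      have := hA' i
      have := hB' i
      have := hV i
      have := hC' i
      omega

/-- If there is no tight polygon, the heights of the ascending segments starting at height `1`
strictly decrease from left to right. -/
theorem height_lt_of_not_hasTight {f H : ℤ → ℤ} {N : ℤ} (hf : ∀ i, f (i + 1) ≤ f i + 1)
    (hpos : ∀ i, 1 ≤ i → i ≤ N → 1 ≤ f i)
    (hH : ∀ i, 1 ≤ i → i ≤ N → 0 ≤ H i ∧ i + H i ≤ N ∧
      (∀ s, 0 ≤ s → s ≤ H i → f (i + s) = f i + s) ∧ f (i + H i + 1) ≠ f i + H i + 1)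
    (hT : ¬ HasTight f N) (k : ℕ) :
    ∀ i j, 1 ≤ i → i < j → j ≤ N → f i = 1 → f j = 1 → j - i ≤ k → H j < H i := by
  induction k with
  | zero =>
    intro i j _ h1 _ _ _ h2
    push_cast at h2
    omega
  | succ k ih =>
    intro i j hi hij hj hfi hfj hk
    push_cast at hk
    by_cases hex : ∃ l, i < l ∧ l < j ∧ f l = 1
    · obtain ⟨l, h1, h2, h3⟩ := hex
      exact (ih l j (by omega) h2 hj h3 hfj (by omega)).trans
        (ih i l hi h1 (by omega) hfi h3 (by omega))
    · push Not at hex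
      by_contra hlt
      obtain ⟨hi0, hiN, hirun, hix⟩ := hH i hi (by omega)
      obtain ⟨hj0, hjN, hjrun, hjx⟩ := hH j (by omega) hj
      have hlt' : i + H i < j := by
        by_contra h
        have := hirun (j - i) (by omega) (by omega)
        rw [add_sub_cancel] at this
        omega
      have hprev := hpos (j - 1) (by omega) (by omega)
      refine hT ((hasTight_of_polygon hf N (j + H i - i).toNat).1 i j (H i) hi (by omega)
        ⟨hi0, hlt', hirun, fun s hs hs' => ?_, hix, by omega⟩
        (Or.inl fun l h1 h2 => ?_) (by omega))
      · have := hjrun s hs (by omega)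
        omega
      · have := hex l (by omega) h2
        omega

/-- The function whose graph over `[1, σ.length]` is `G(σ)`, extended so that it never rises by
more than one; `c` should bound the entries of `σ`. -/
def dotFun (σ : List ℕ) (c : ℕ) (i : ℤ) : ℤ :=
  if i ≤ 0 then c else (σ.getD (i - 1).toNat 0 : ℕ)

theorem dotFun_natCast_add_one (σ : List ℕ) (c k : ℕ) :
    dotFun σ c ((k : ℤ) + 1) = (σ.getD k 0 : ℕ) := by
  rw [dotFun, if_neg (by omega), add_sub_cancel_right, Int.toNat_natCast]

theorem isDot_iff_dotFun (σ : List ℕ) (c : ℕ) (i j : ℤ) :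
    IsDot σ i j ↔ 1 ≤ i ∧ i ≤ (σ.length : ℤ) ∧ dotFun σ c i = j := by
  constructor
  · rintro ⟨⟨k, hk⟩, rfl, rfl⟩
    refine ⟨by simp, by simp; omega, ?_⟩
    rw [dotFun_natCast_add_one, List.getD_eq_getElem _ _ hk]
    rfl
  · rintro ⟨h1, h2, rfl⟩
    obtain ⟨k, rfl⟩ : ∃ k : ℕ, i = k + 1 := ⟨(i - 1).toNat, by omega⟩
    have hk : k < σ.length := by omega
    refine ⟨⟨k, hk⟩, rfl, ?_⟩
    rw [dotFun_natCast_add_one, List.getD_eq_getElem _ _ hk]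
    rfl

theorem dotFun_succ_le {σ : List ℕ} (hsaw : Sawtooth σ) {c : ℕ} (hc : ∀ x ∈ σ, x ≤ c) (i : ℤ) :
    dotFun σ c (i + 1) ≤ dotFun σ c i + 1 := by
  have hle : ∀ k, σ.getD k 0 ≤ c := fun k => by
    by_cases hk : k < σ.length
    · rw [List.getD_eq_getElem _ _ hk]
      exact hc _ (List.getElem_mem hk)
    · rw [List.getD_eq_default _ _ (by omega)]
      exact Nat.zero_le _
  by_cases hi : i ≤ 0
  · rw [dotFun, dotFun, if_pos hi]
    split_ifs
    · omega
    · have := hle (i + 1 - 1).toNat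
      omega
  · obtain ⟨k, rfl⟩ : ∃ k : ℕ, i = k + 1 := ⟨(i - 1).toNat, by omega⟩
    have h1 := dotFun_natCast_add_one σ c k
    have h2 := dotFun_natCast_add_one σ c (k + 1)
    push_cast at h2
    rw [h1, h2]
    by_cases hk : k + 1 < σ.length
    · have := hsaw k hk
      omega
    · rw [List.getD_eq_default σ (n := k + 1) _ (by omega)]
      omega

/-- If `σ` is in sawtooth form, has all entries in `{1, …, n−1}`
(where `n ≥ 2`), and has more than `n−1` entries equal to 1, then `G(σ)` contains an
empty unpierced box or an empty unpierced hexagon of type 1 or 2. -/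
theorem exists_empty_unpierced_of_many_ones (n : ℕ) (hn : 2 ≤ n) (σ : List ℕ)
    (hsaw : Sawtooth σ) (hrange : ∀ x ∈ σ, 1 ≤ x ∧ x ≤ n - 1)
    (hcount : n - 1 < σ.count 1) :
    ∃ P : DGPoly, P.Valid σ ∧ P.Unpierced σ ∧ P.IsEmpty σ := by
  by_contra hP
  have hT : ¬ HasTight (dotFun σ (n - 1)) σ.length :=
    fun h => hP (exists_poly_of_hasTight (isDot_iff_dotFun σ (n - 1)) h)
  have hf := dotFun_succ_le hsaw (c := n - 1) fun x hx => (hrange x hx).2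
  have hval : ∀ i, 1 ≤ i → i ≤ (σ.length : ℤ) →
      1 ≤ dotFun σ (n - 1) i ∧ dotFun σ (n - 1) i ≤ (n : ℤ) - 1 := by
    intro i h1 h2
    obtain ⟨k, rfl⟩ : ∃ k : ℕ, i = k + 1 := ⟨(i - 1).toNat, by omega⟩
    have hk : k < σ.length := by omega
    rw [dotFun_natCast_add_one, List.getD_eq_getElem _ _ hk]
    have := hrange _ (List.getElem_mem hk)
    omega
  have hend : dotFun σ (n - 1) (σ.length + 1) = 0 := by
    rw [dotFun_natCast_add_one, List.getD_eq_default _ _ le_rfl, Nat.cast_zero]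
  have hex : ∀ i, ∃ h, 1 ≤ i → i ≤ (σ.length : ℤ) → 0 ≤ h ∧ i + h ≤ σ.length ∧
      (∀ s, 0 ≤ s → s ≤ h → dotFun σ (n - 1) (i + s) = dotFun σ (n - 1) i + s) ∧
      dotFun σ (n - 1) (i + h + 1) ≠ dotFun σ (n - 1) i + h + 1 := by
    intro i
    by_cases hi : 1 ≤ i ∧ i ≤ (σ.length : ℤ)
    · have hl := hval σ.length (by omega) le_rfl
      obtain ⟨h, hh⟩ := exists_run_right (dotFun σ (n - 1)) hi.2 (by omega)
      exact ⟨h, fun _ _ => hh⟩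
    · exact ⟨0, fun h1 h2 => absurd ⟨h1, h2⟩ hi⟩
  choose H hH using hex
  have hlt := height_lt_of_not_hasTight hf (fun i h1 h2 => (hval i h1 h2).1) hH hT σ.length
  have hcard := Fin.card_filter_univ_eq_vector_get_eq_count 1 (⟨σ, rfl⟩ : List.Vector ℕ σ.length)
  have hone : ∀ k : Fin σ.length, List.Vector.get (⟨σ, rfl⟩ : List.Vector ℕ σ.length) k = 1 →
      dotFun σ (n - 1) ((k : ℕ) + 1) = 1 := by
    intro k hk
    rw [dotFun_natCast_add_one, List.getD_eq_getElem _ _ k.2]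
    exact_mod_cast hk
  have hle := Finset.card_le_card_of_injOn
    (s := {k | 1 = List.Vector.get (⟨σ, rfl⟩ : List.Vector ℕ σ.length) k})
    (t := Finset.range (n - 1)) (fun k => (H ((k : ℕ) + 1)).toNat)
    (fun k hk => by
      have hk1 := hone k (by simpa [eq_comm] using hk)
      have h1 := hH ((k : ℕ) + 1) (by omega) (by omega)
      have h2 := h1.2.2.1 _ h1.1 le_rfl
      have h3 := hval ((k : ℕ) + 1 + H ((k : ℕ) + 1)) (by omega) h1.2.1
      simp only [Finset.coe_range, Set.mem_Iio]
      omega)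
    (fun k hk l hl hkl => by
      have hk1 := hone k (by simpa [eq_comm] using hk)
      have hl1 := hone l (by simpa [eq_comm] using hl)
      have h1 := hH ((k : ℕ) + 1) (by omega) (by omega)
      have h2 := hH ((l : ℕ) + 1) (by omega) (by omega)
      simp only at hkl
      rcases lt_trichotomy (k : ℕ) (l : ℕ) with h | h | h
      · have := hlt _ _ (by omega) (by omega) (by omega) hk1 hl1 (by omega)
        omega
      · exact Fin.ext h
      · have := hlt _ _ (by omega) (by omega) (by omega) hl1 hk1 (by omega)
        omega)
  simp only [eq_comm, Finset.card_range] at hle hcard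
  simp only [List.Vector.toList] at hcard
  omega
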